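/- arXiv:2408.01846 — 4 statements merged into one kernel-verified Lean document; each statement's English description precedes it below -/
import Mathlib

section
/- Let A be a ℤ/2-graded supercommutative ring with a super-Poisson bracket {·,·}, and fix Dirac constraint data (φ_α, Φ_{αβ}) as in the context, with {f,g}_D the Dirac superbracket. Then for all homogeneous f, g, h ∈ A, the Dirac superbracket satisfies the super Leibniz rule: {f, gh}_D = {f,g}_D·h + (−1)^{∂f·∂g} g·{f,h}_D. -/
/-- The Dirac superbracket `{f,g}_D = {f,g} + Σ_{α,β} Φ_{αβ}·{f,φ_α}·{φ_β,g}`. -/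
def diracBr {A : Type*} [Ring A] {n : ℕ} (br : A → A → A) (φ : Fin n → A)
    (Φ : Fin n → Fin n → A) (f g : A) : A :=
  br f g + ∑ α, ∑ β, Φ α β * br f (φ α) * br (φ β) g

theorem parity_aux : ∀ a b i j : ZMod 2,
    (Even (b.val * j.val + (a + b + (i + a)).val * j.val) ↔ Even (i.val * j.val)) := by
  decide

/-- the Dirac superbracket satisfies the super Leibniz rule on
homogeneous elements. -/
theorem stmt_3 {A : Type*} [Ring A] (𝒜 : ZMod 2 → AddSubgroup A)
    (hdirect : DirectSum.IsInternal 𝒜)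
    (hgmul : ∀ {i j : ZMod 2} {x y : A}, x ∈ 𝒜 i → y ∈ 𝒜 j → x * y ∈ 𝒜 (i + j))
    (hcomm : ∀ {i j : ZMod 2} {x y : A}, x ∈ 𝒜 i → y ∈ 𝒜 j →
      x * y = (-1 : A) ^ (i.val * j.val) * (y * x))
    (br : A → A → A)
    (hbl : ∀ x y z : A, br (x + y) z = br x z + br y z)
    (hbr : ∀ x y z : A, br x (y + z) = br x y + br x z)
    (hpar : ∀ {i j : ZMod 2} {x y : A}, x ∈ 𝒜 i → y ∈ 𝒜 j → br x y ∈ 𝒜 (i + j))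
    (hskew : ∀ {i j : ZMod 2} {x y : A}, x ∈ 𝒜 i → y ∈ 𝒜 j →
      br x y = -((-1 : A) ^ (i.val * j.val) * br y x))
    (hleib : ∀ {i j k : ZMod 2} {x y z : A}, x ∈ 𝒜 i → y ∈ 𝒜 j → z ∈ 𝒜 k →
      br x (y * z) = br x y * z + (-1 : A) ^ (i.val * j.val) * (y * br x z))
    (hjac : ∀ {i j k : ZMod 2} {x y z : A}, x ∈ 𝒜 i → y ∈ 𝒜 j → z ∈ 𝒜 k →
      (-1 : A) ^ (i.val * k.val) * br x (br y z)
        + (-1 : A) ^ (i.val * j.val) * br y (br z x)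
        + (-1 : A) ^ (j.val * k.val) * br z (br x y) = 0)
    -- Dirac constraint data
    (n : ℕ) (φ : Fin n → A) (p : Fin n → ZMod 2) (hφ : ∀ α, φ α ∈ 𝒜 (p α))
    (Φ : Fin n → Fin n → A) (hΦmem : ∀ α β, Φ α β ∈ 𝒜 (p α + p β))
    (hinv₁ : ∀ α γ, ∑ β, Φ α β * br (φ β) (φ γ) = if α = γ then (1 : A) else 0)
    (hinv₂ : ∀ α γ, ∑ β, br (φ α) (φ β) * Φ β γ = if α = γ then (1 : A) else 0)
    (hΦskew : ∀ α β, Φ α β = -((-1 : A) ^ ((p α).val * (p β).val) * Φ β α))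
    -- homogeneous elements
    (i j k : ZMod 2) (f g h : A) (hf : f ∈ 𝒜 i) (hg : g ∈ 𝒜 j) (hh : h ∈ 𝒜 k) :
    diracBr br φ Φ f (g * h)
      = diracBr br φ Φ f g * h
        + (-1 : A) ^ (i.val * j.val) * (g * diracBr br φ Φ f h) := by
  have key : ∀ α β, Φ α β * br f (φ α) * br (φ β) (g * h)
      = Φ α β * br f (φ α) * br (φ β) g * h
        + (-1 : A) ^ (i.val * j.val) * (g * (Φ α β * br f (φ α) * br (φ β) h)) := by
    intro α β
    have hm := hgmul (hΦmem α β) (hpar hf (hφ α))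
    have hc := hcomm hm hg
    rw [hleib (hφ β) hg hh]
    generalize Φ α β * br f (φ α) = X at *
    generalize p α = a at *
    generalize p β = b at *
    have hX : X * ((-1 : A) ^ (b.val * j.val) * (g * br (φ β) h))
        = (-1 : A) ^ (b.val * j.val) * (X * g * br (φ β) h) := by
      rw [← mul_assoc X, ((Commute.neg_one_right X).pow_right _).eq, mul_assoc, mul_assoc X]
    rw [mul_add, hX, hc, ← mul_assoc X]
    congr 1
    simp only [← mul_assoc, ← pow_add]
    have hs : (-1 : A) ^ (b.val * j.val + (a + b + (i + a)).val * j.val)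
        = (-1 : A) ^ (i.val * j.val) := by
      apply neg_one_pow_congr
      exact parity_aux a b i j
    rw [hs]
  unfold diracBr
  rw [hleib hf hg hh]
  simp only [key, Finset.sum_add_distrib, add_mul, mul_add, Finset.sum_mul, Finset.mul_sum]
  abel
end

section
/- Let A be a ℤ/2-graded supercommutative ring and {·,·} a biadditive parity-additive bracket on A that, on homogeneous elements, satisfies super skew-symmetry {f,g} = −(−1)^{∂f·∂g}{g,f} and the super Leibniz rule {f, gh} = {f,g}h + (−1)^{∂f·∂g} g{f,h}. Assume the Jacobi identity {f,{g,h}} + {g,{h,f}} + {h,{f,g}} = 0 holds whenever f, g, h are homogeneous of equal parity. Let b₁ = ε·f₃ be an even element that is a product of two odd homogeneous elements ε, f₃ ∈ A₁, and let f₁, f₂ ∈ A₁ be odd homogeneous. Then the super Jacobi identity holds for the triple (b₁, f₁, f₂): {b₁,{f₁,f₂}} + {f₁,{f₂,b₁}} − {f₂,{b₁,f₁}} = 0. -/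
/-- super Jacobi identity for the triple `(b₁, f₁, f₂)` with
`b₁ = ε·f₃` even (a product of two odd homogeneous elements) and `f₁, f₂` odd:
`{b₁,{f₁,f₂}} + {f₁,{f₂,b₁}} − {f₂,{b₁,f₁}} = 0`. -/
theorem stmt_8 {A : Type*} [Ring A] (𝒜 : ZMod 2 → AddSubgroup A)
    (hdirect : DirectSum.IsInternal 𝒜)
    (hgmul : ∀ {i j : ZMod 2} {x y : A}, x ∈ 𝒜 i → y ∈ 𝒜 j → x * y ∈ 𝒜 (i + j))
    (hcomm : ∀ {i j : ZMod 2} {x y : A}, x ∈ 𝒜 i → y ∈ 𝒜 j →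
      x * y = (-1 : A) ^ (i.val * j.val) * (y * x))
    (br : A → A → A)
    (hbl : ∀ x y z : A, br (x + y) z = br x z + br y z)
    (hbr : ∀ x y z : A, br x (y + z) = br x y + br x z)
    (hpar : ∀ {i j : ZMod 2} {x y : A}, x ∈ 𝒜 i → y ∈ 𝒜 j → br x y ∈ 𝒜 (i + j))
    (hskew : ∀ {i j : ZMod 2} {x y : A}, x ∈ 𝒜 i → y ∈ 𝒜 j →
      br x y = -((-1 : A) ^ (i.val * j.val) * br y x))
    (hleib : ∀ {i j k : ZMod 2} {x y z : A}, x ∈ 𝒜 i → y ∈ 𝒜 j → z ∈ 𝒜 k →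
      br x (y * z) = br x y * z + (-1 : A) ^ (i.val * j.val) * (y * br x z))
    (hjaceq : ∀ (i : ZMod 2) (x y z : A), x ∈ 𝒜 i → y ∈ 𝒜 i → z ∈ 𝒜 i →
      br x (br y z) + br y (br z x) + br z (br x y) = 0)
    (ε f₃ f₁ f₂ : A) (hε : ε ∈ 𝒜 1) (hf₃ : f₃ ∈ 𝒜 1)
    (hf₁ : f₁ ∈ 𝒜 1) (hf₂ : f₂ ∈ 𝒜 1)
    (b₁ : A) (hb₁ : b₁ = ε * f₃) :
    br b₁ (br f₁ f₂) + br f₁ (br f₂ b₁) - br f₂ (br b₁ f₁) = 0 := by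
  subst hb₁
  have v0 : (0 : ZMod 2).val = 0 := rfl
  have v1 : (1 : ZMod 2).val = 1 := rfl
  have h11 : (1 : ZMod 2) + 1 = 0 := rfl
  have par : ∀ {x y : A}, x ∈ 𝒜 1 → y ∈ 𝒜 1 → br x y ∈ 𝒜 0 := by
    intro x y hx hy
    have h := hpar hx hy
    rwa [h11] at h
  have mul : ∀ {x y : A}, x ∈ 𝒜 1 → y ∈ 𝒜 1 → x * y ∈ 𝒜 0 := by
    intro x y hx hy
    have h := hgmul hx hy
    rwa [h11] at h
  have mul01 : ∀ {x y : A}, x ∈ 𝒜 0 → y ∈ 𝒜 1 → x * y ∈ 𝒜 1 := by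
    intro x y hx hy
    have h := hgmul hx hy
    rwa [zero_add] at h
  have sk11 : ∀ {x y : A}, x ∈ 𝒜 1 → y ∈ 𝒜 1 → br x y = br y x := by
    intro x y hx hy
    simpa [v1] using hskew hx hy
  have sk0 : ∀ {x y : A} {j : ZMod 2}, x ∈ 𝒜 0 → y ∈ 𝒜 j → br x y = - br y x := by
    intro x y j hx hy
    simpa [v0] using hskew hx hy
  have l0 : ∀ {x y z : A} {j k : ZMod 2}, x ∈ 𝒜 0 → y ∈ 𝒜 j → z ∈ 𝒜 k →
      br x (y * z) = br x y * z + y * br x z := by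
    intro x y z j k hx hy hz
    simpa [v0] using hleib hx hy hz
  have l10 : ∀ {x y z : A} {k : ZMod 2}, x ∈ 𝒜 1 → y ∈ 𝒜 0 → z ∈ 𝒜 k →
      br x (y * z) = br x y * z + y * br x z := by
    intro x y z k hx hy hz
    simpa [v0] using hleib hx hy hz
  have l11 : ∀ {x y z : A} {k : ZMod 2}, x ∈ 𝒜 1 → y ∈ 𝒜 1 → z ∈ 𝒜 k →
      br x (y * z) = br x y * z - y * br x z := by
    intro x y z k hx hy hz
    simpa [v1, sub_eq_add_neg] using hleib hx hy hz
  have brsub : ∀ x y z : A, br x (y - z) = br x y - br x z := by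
    intro x y z
    have h := hbr x (y - z) z
    rw [sub_add_cancel] at h
    rw [h, add_sub_cancel_right]
  have brneg : ∀ x y : A, br x (-y) = - br x y := by
    intro x y
    have h0 : br x 0 = 0 := by simpa using brsub x 0 0
    have h := brsub x 0 y
    rwa [zero_sub, h0, zero_sub] at h
  -- the double bracket of two odd elements with the product
  have key : ∀ {x y : A}, x ∈ 𝒜 1 → y ∈ 𝒜 1 → br x (br y (ε * f₃)) =
      br x (br y ε) * f₃ + br y ε * br x f₃ - (br x ε * br y f₃ - ε * br x (br y f₃)) := by
    intro x y hx hy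
    rw [l11 hy hε hf₃, brsub, l10 hx (par hy hε) hf₃, l11 hx hε (par hy hf₃)]
  have jac : ∀ {z : A}, z ∈ 𝒜 1 →
      br (br f₁ f₂) z = br f₁ (br f₂ z) + br f₂ (br f₁ z) := by
    intro z hz
    have h := hjaceq 1 f₁ f₂ z hf₁ hf₂ hz
    rw [sk11 hz hf₁] at h
    rw [sk0 (par hf₁ hf₂) hz]
    exact (eq_neg_of_add_eq_zero_left h).symm
  rw [sk0 (mul hε hf₃) hf₁, brneg, sk0 (mul hε hf₃) (par hf₁ hf₂), key hf₁ hf₂, key hf₂ hf₁,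
    l0 (par hf₁ hf₂) hε hf₃, jac hε, jac hf₃]
  noncomm_ring
end

section
/- Let A be a ℤ/2-graded supercommutative ring and {·,·} a biadditive parity-additive bracket on A that, on homogeneous elements, satisfies super skew-symmetry {f,g} = −(−1)^{∂f·∂g}{g,f} and the super Leibniz rule {f, gh} = {f,g}h + (−1)^{∂f·∂g} g{f,h}. Assume the Jacobi identity {f,{g,h}} + {g,{h,f}} + {h,{f,g}} = 0 holds whenever f, g, h are homogeneous of equal parity. Let b₁ = ε₁·f₁ and b₂ = ε₂·f₂ be even elements that are products of odd homogeneous elements ε₁, f₁, ε₂, f₂ ∈ A₁, and let f₃ ∈ A₁ be odd homogeneous. Then the super Jacobi identity holds for the triple (b₁, b₂, f₃): {b₁,{b₂,f₃}} + {b₂,{f₃,b₁}} + {f₃,{b₁,b₂}} = 0. -/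
/-- super Jacobi identity for the triple `(b₁, b₂, f₃)` with
`b₁ = ε₁·f₁`, `b₂ = ε₂·f₂` even (products of odd homogeneous elements) and
`f₃` odd: `{b₁,{b₂,f₃}} + {b₂,{f₃,b₁}} + {f₃,{b₁,b₂}} = 0`. -/
theorem stmt_9 {A : Type*} [Ring A] (𝒜 : ZMod 2 → AddSubgroup A)
    (hdirect : DirectSum.IsInternal 𝒜)
    (hgmul : ∀ {i j : ZMod 2} {x y : A}, x ∈ 𝒜 i → y ∈ 𝒜 j → x * y ∈ 𝒜 (i + j))
    (hcomm : ∀ {i j : ZMod 2} {x y : A}, x ∈ 𝒜 i → y ∈ 𝒜 j →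
      x * y = (-1 : A) ^ (i.val * j.val) * (y * x))
    (br : A → A → A)
    (hbl : ∀ x y z : A, br (x + y) z = br x z + br y z)
    (hbr : ∀ x y z : A, br x (y + z) = br x y + br x z)
    (hpar : ∀ {i j : ZMod 2} {x y : A}, x ∈ 𝒜 i → y ∈ 𝒜 j → br x y ∈ 𝒜 (i + j))
    (hskew : ∀ {i j : ZMod 2} {x y : A}, x ∈ 𝒜 i → y ∈ 𝒜 j →
      br x y = -((-1 : A) ^ (i.val * j.val) * br y x))
    (hleib : ∀ {i j k : ZMod 2} {x y z : A}, x ∈ 𝒜 i → y ∈ 𝒜 j → z ∈ 𝒜 k →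
      br x (y * z) = br x y * z + (-1 : A) ^ (i.val * j.val) * (y * br x z))
    (hjaceq : ∀ (i : ZMod 2) (x y z : A), x ∈ 𝒜 i → y ∈ 𝒜 i → z ∈ 𝒜 i →
      br x (br y z) + br y (br z x) + br z (br x y) = 0)
    (ε₁ f₁ ε₂ f₂ f₃ : A) (hε₁ : ε₁ ∈ 𝒜 1) (hf₁ : f₁ ∈ 𝒜 1)
    (hε₂ : ε₂ ∈ 𝒜 1) (hf₂ : f₂ ∈ 𝒜 1) (hf₃ : f₃ ∈ 𝒜 1)
    (b₁ b₂ : A) (hb₁ : b₁ = ε₁ * f₁) (hb₂ : b₂ = ε₂ * f₂) :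
    br b₁ (br b₂ f₃) + br b₂ (br f₃ b₁) + br f₃ (br b₁ b₂) = 0 := by
  have hnr : ∀ x y : A, br x (-y) = -br x y := fun x y =>
    (AddMonoidHom.mk' (br x) (hbr x)).map_neg y
  have hnl : ∀ x y : A, br (-x) y = -br x y := fun x y =>
    (AddMonoidHom.mk' (fun t => br t y) (fun a b => hbl a b y)).map_neg x
  have v1 : (1 : ZMod 2).val = 1 := rfl
  have v0 : (0 : ZMod 2).val = 0 := rfl
  have m11 : ∀ {x y : A}, x ∈ 𝒜 1 → y ∈ 𝒜 1 → br x y ∈ 𝒜 0 := fun hx hy => hpar hx hy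
  have m10 : ∀ {x y : A}, x ∈ 𝒜 1 → y ∈ 𝒜 0 → br x y ∈ 𝒜 1 := fun hx hy => hpar hx hy
  have m01 : ∀ {x y : A}, x ∈ 𝒜 0 → y ∈ 𝒜 1 → br x y ∈ 𝒜 1 := fun hx hy => hpar hx hy
  have p11 : ∀ {x y : A}, x ∈ 𝒜 1 → y ∈ 𝒜 1 → x * y ∈ 𝒜 0 := fun hx hy => hgmul hx hy
  have s11 : ∀ {x y : A}, x ∈ 𝒜 1 → y ∈ 𝒜 1 → br x y = br y x := fun hx hy => by
    rw [hskew hx hy]; simp [v1]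
  have s10 : ∀ {x y : A}, x ∈ 𝒜 1 → y ∈ 𝒜 0 → br x y = -br y x := fun hx hy => by
    rw [hskew hx hy]; simp [v0]
  have s00 : ∀ {x y : A}, x ∈ 𝒜 0 → y ∈ 𝒜 0 → br x y = -br y x := fun hx hy => by
    rw [hskew hx hy]; simp [v0]
  have l1 : ∀ {x y z : A}, x ∈ 𝒜 1 → y ∈ 𝒜 1 → z ∈ 𝒜 1 →
      br x (y * z) = br x y * z - y * br x z := fun hx hy hz => by
    rw [hleib hx hy hz]; simp [v1, sub_eq_add_neg]
  have l110 : ∀ {x y z : A}, x ∈ 𝒜 1 → y ∈ 𝒜 1 → z ∈ 𝒜 0 →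
      br x (y * z) = br x y * z - y * br x z := fun hx hy hz => by
    rw [hleib hx hy hz]; simp [v1, sub_eq_add_neg]
  have l101 : ∀ {x y z : A}, x ∈ 𝒜 1 → y ∈ 𝒜 0 → z ∈ 𝒜 1 →
      br x (y * z) = br x y * z + y * br x z := fun hx hy hz => by
    rw [hleib hx hy hz]; simp [v0]
  have l0 : ∀ {x y z : A}, x ∈ 𝒜 0 → y ∈ 𝒜 1 → z ∈ 𝒜 1 →
      br x (y * z) = br x y * z + y * br x z := fun hx hy hz => by
    rw [hleib hx hy hz]; simp [v0]
  have l001 : ∀ {x y z : A}, x ∈ 𝒜 0 → y ∈ 𝒜 0 → z ∈ 𝒜 1 →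
      br x (y * z) = br x y * z + y * br x z := fun hx hy hz => by
    rw [hleib hx hy hz]; simp [v0]
  have l010 : ∀ {x y z : A}, x ∈ 𝒜 0 → y ∈ 𝒜 1 → z ∈ 𝒜 0 →
      br x (y * z) = br x y * z + y * br x z := fun hx hy hz => by
    rw [hleib hx hy hz]; simp [v0]
  -- the Jacobi identity for three odd elements, in derivation form
  have J : ∀ {x y z : A}, x ∈ 𝒜 1 → y ∈ 𝒜 1 → z ∈ 𝒜 1 →
      br (br x y) z = br x (br y z) + br y (br x z) := fun {x y z} hx hy hz => by
    have h := hjaceq 1 x y z hx hy hz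
    rw [s11 hz hx, s10 hz (m11 hx hy)] at h
    exact (add_neg_eq_zero.mp h).symm
  -- odd, odd, product of two odd elements
  have K : ∀ {x y z w : A}, x ∈ 𝒜 1 → y ∈ 𝒜 1 → z ∈ 𝒜 1 → w ∈ 𝒜 1 →
      br (br x y) (z * w) = br x (br y (z * w)) + br y (br x (z * w)) :=
    fun {x y z w} hx hy hz hw => by
    rw [l0 (m11 hx hy) hz hw, l1 hx hz hw, l1 hy hz hw, J hx hy hz, J hx hy hw]
    simp only [sub_eq_add_neg, hbr, hnr]
    rw [l101 hx (m11 hy hz) hw, l110 hx hz (m11 hy hw), l101 hy (m11 hx hz) hw,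
      l110 hy hz (m11 hx hw)]
    noncomm_ring
  subst hb₁ hb₂
  have e1 := p11 hε₁ hf₁
  have e2 := p11 hε₂ hf₂
  -- odd `f₃`, even `b₂`, odd `z`
  have L : ∀ {z : A}, z ∈ 𝒜 1 → br (br f₃ (ε₂ * f₂)) z =
      br f₃ (br (ε₂ * f₂) z) - br (ε₂ * f₂) (br f₃ z) := fun {z} hz => by
    have h := K hf₃ hz hε₂ hf₂
    rw [s00 (m11 hf₃ hz) e2, s10 hz e2, hnr, s11 hz (m10 hf₃ e2)] at h
    rw [sub_eq_add_neg, h]; abel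
  have M : br (br f₃ (ε₂ * f₂)) (ε₁ * f₁) =
      br f₃ (br (ε₂ * f₂) (ε₁ * f₁)) - br (ε₂ * f₂) (br f₃ (ε₁ * f₁)) := by
    generalize ε₂ * f₂ = b at *
    rw [l1 (m10 hf₃ e2) hε₁ hf₁, l0 e2 hε₁ hf₁, l1 hf₃ hε₁ hf₁, L hε₁, L hf₁]
    simp only [sub_eq_add_neg, hbr, hnr]
    rw [l1 hf₃ (m01 e2 hε₁) hf₁, l1 hf₃ hε₁ (m01 e2 hf₁), l001 e2 (m11 hf₃ hε₁) hf₁,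
      l010 e2 hε₁ (m11 hf₃ hf₁)]
    noncomm_ring
  have g1 : br (ε₁ * f₁) (br (ε₂ * f₂) f₃) = br (br f₃ (ε₂ * f₂)) (ε₁ * f₁) := by
    rw [s10 (m10 hf₃ e2) e1, s10 hf₃ e2, hnr, neg_neg]
  rw [g1, s00 e1 e2, hnr, M]
  abel
end

section
/- Let A be a ℤ/2-graded supercommutative ring with a super-Poisson bracket {·,·}, and fix Dirac constraint data (φ_α, Φ_{αβ}) as in the context, with {f,g}_D the Dirac superbracket. Let f, g ∈ A be homogeneous and suppose that for every pair of indices α, β the quantity Ξ_{αβ} = ∂f·p_α + p_β·∂g + ∂f·p_β + p_α·∂g is even. Then {f,g}_D = −(−1)^{∂f·∂g}{g,f}_D. -/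
/-- if `Ξ_{αβ} = ∂f·p_α + p_β·∂g + ∂f·p_β + p_α·∂g` is even for all
indices `α, β`, then the Dirac superbracket of the homogeneous elements `f, g` is
super skew-symmetric. -/
theorem stmt_10 {A : Type*} [Ring A] (𝒜 : ZMod 2 → AddSubgroup A)
    (hdirect : DirectSum.IsInternal 𝒜)
    (hgmul : ∀ {i j : ZMod 2} {x y : A}, x ∈ 𝒜 i → y ∈ 𝒜 j → x * y ∈ 𝒜 (i + j))
    (hcomm : ∀ {i j : ZMod 2} {x y : A}, x ∈ 𝒜 i → y ∈ 𝒜 j →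
      x * y = (-1 : A) ^ (i.val * j.val) * (y * x))
    (br : A → A → A)
    (hbl : ∀ x y z : A, br (x + y) z = br x z + br y z)
    (hbr : ∀ x y z : A, br x (y + z) = br x y + br x z)
    (hpar : ∀ {i j : ZMod 2} {x y : A}, x ∈ 𝒜 i → y ∈ 𝒜 j → br x y ∈ 𝒜 (i + j))
    (hskew : ∀ {i j : ZMod 2} {x y : A}, x ∈ 𝒜 i → y ∈ 𝒜 j →
      br x y = -((-1 : A) ^ (i.val * j.val) * br y x))
    (hleib : ∀ {i j k : ZMod 2} {x y z : A}, x ∈ 𝒜 i → y ∈ 𝒜 j → z ∈ 𝒜 k →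
      br x (y * z) = br x y * z + (-1 : A) ^ (i.val * j.val) * (y * br x z))
    (hjac : ∀ {i j k : ZMod 2} {x y z : A}, x ∈ 𝒜 i → y ∈ 𝒜 j → z ∈ 𝒜 k →
      (-1 : A) ^ (i.val * k.val) * br x (br y z)
        + (-1 : A) ^ (i.val * j.val) * br y (br z x)
        + (-1 : A) ^ (j.val * k.val) * br z (br x y) = 0)
    -- Dirac constraint data
    (n : ℕ) (φ : Fin n → A) (p : Fin n → ZMod 2) (hφ : ∀ α, φ α ∈ 𝒜 (p α))
    (Φ : Fin n → Fin n → A) (hΦmem : ∀ α β, Φ α β ∈ 𝒜 (p α + p β))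
    (hinv₁ : ∀ α γ, ∑ β, Φ α β * br (φ β) (φ γ) = if α = γ then (1 : A) else 0)
    (hinv₂ : ∀ α γ, ∑ β, br (φ α) (φ β) * Φ β γ = if α = γ then (1 : A) else 0)
    (hΦskew : ∀ α β, Φ α β = -((-1 : A) ^ ((p α).val * (p β).val) * Φ β α))
    -- homogeneous elements with even `Ξ_{αβ}`
    (i j : ZMod 2) (f g : A) (hf : f ∈ 𝒜 i) (hg : g ∈ 𝒜 j)
    (hΞ : ∀ α β, Even (i.val * (p α).val + (p β).val * j.val
      + i.val * (p β).val + (p α).val * j.val)) :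
    diracBr br φ Φ f g = -((-1 : A) ^ (i.val * j.val) * diracBr br φ Φ g f) := by
  have key : ∀ α β, Φ α β * br f (φ α) * br (φ β) g
      = -((-1 : A) ^ (i.val * j.val) * (Φ β α * br g (φ β) * br (φ α) f)) := by
    intro α β
    have h1 := hΦskew α β
    have h2 := hskew hf (hφ α)
    have h3 := hskew (hφ β) hg
    have h4 := hcomm (hpar (hφ α) hf) (hpar hg (hφ β))
    have h5 := hΞ α β
    rw [h1, h2, h3]
    generalize p α = a at *
    generalize p β = b at *
    have two : ∀ x : ZMod 2, x = 0 ∨ x = 1 := by decide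
    have v1 : (1 : ZMod 2).val = 1 := rfl
    have v2 : (1 + 1 : ZMod 2).val = 0 := rfl
    clear h1 h2 h3
    rcases two i with rfl | rfl <;> rcases two j with rfl | rfl <;>
      rcases two a with rfl | rfl <;> rcases two b with rfl | rfl <;>
      first
      | (exfalso; revert h5; decide)
      | (simp [v1, v2] at h4
         simp [v1, mul_assoc, h4])
  unfold diracBr
  rw [hskew hf hg, mul_add, neg_add, Finset.sum_comm (f := fun α β => Φ α β * br g (φ α) * br (φ β) f)]
  congr 1
  simp only [key, Finset.mul_sum, Finset.sum_neg_distrib]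
end
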